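/- Let a < b be extended reals and let f be holomorphic on the horizontal strip S_{a,b}. Then the following are equivalent: (1) f is positive definite on S_{a,b}; (2) there exists a nonnegative Borel measure μ on ℝ such that f(z) = ∫ℝ e^{izt} dμ(t) for all z ∈ S_{a,b}; (3) there exists y ∈ (a,b) such that the real-variable function x ↦ f(x+iy) is positive definite on ℝ; (4) the function y ↦ f(iy) is co-positive definite on the interval (a,b). Moreover, in this case the measure μ in (2) is uniquely determined by f and is exponentially finite with respect to (a,b). -/

import Mathlib

open Complex MeasureTheory Filter Set Topology
open scoped Real BigOperators ComplexOrder

noncomputable section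

/-- `f : ℝ → ℂ` is positive definite. -/
def IsPosDefFun (f : ℝ → ℂ) : Prop :=
  ∀ (n : ℕ) (x : Fin n → ℝ) (ξ : Fin n → ℂ),
    0 ≤ ∑ k, ∑ l, f (x k - x l) * ξ k * (starRingEnd ℂ) (ξ l)

/-- `f` is positive definite on `S ⊆ ℂ`. -/
def IsPosDefOnC (f : ℂ → ℂ) (S : Set ℂ) : Prop :=
  ∀ (n : ℕ) (z : Fin n → ℂ), (∀ k l, z k - (starRingEnd ℂ) (z l) ∈ S) →
    ∀ ξ : Fin n → ℂ,
      0 ≤ ∑ k, ∑ l, f (z k - (starRingEnd ℂ) (z l)) * ξ k * (starRingEnd ℂ) (ξ l)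

/-- `f` is co-positive definite on `T ⊆ ℂ`. -/
def IsCoPosDefOnC (f : ℂ → ℂ) (T : Set ℂ) : Prop :=
  ∀ (n : ℕ) (z : Fin n → ℂ), (∀ k l, z k + (starRingEnd ℂ) (z l) ∈ T) →
    ∀ ξ : Fin n → ℂ,
      0 ≤ ∑ k, ∑ l, f (z k + (starRingEnd ℂ) (z l)) * ξ k * (starRingEnd ℂ) (ξ l)

/-- `G : ℝ → ℂ` is co-positive definite on `I ⊆ ℝ`. -/
def IsCoPosDefOnR (G : ℝ → ℂ) (I : Set ℝ) : Prop :=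
  ∀ (n : ℕ) (x : Fin n → ℝ), (∀ k l, x k + x l ∈ I) →
    ∀ ξ : Fin n → ℂ,
      0 ≤ ∑ k, ∑ l, G (x k + x l) * ξ k * (starRingEnd ℂ) (ξ l)

/-- Horizontal strip `S_{a,b}`. -/
def HStrip (a b : EReal) : Set ℂ := {z | a < (z.im : EReal) ∧ (z.im : EReal) < b}

/-- Vertical strip `T_{a,b}`. -/
def VStrip (a b : EReal) : Set ℂ := {z | a < (z.re : EReal) ∧ (z.re : EReal) < b}

/-- `μ` is exponentially finite with respect to the interval `(a,b)`. -/
def ExpFinite (μ : Measure ℝ) (a b : EReal) : Prop :=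
  ∀ y : ℝ, a < (y : EReal) → (y : EReal) < b →
    Integrable (fun t : ℝ => Real.exp (-y * t)) μ


lemma expInt_aux (ν : Measure ℝ) (x1 R C : ℝ) (hR : 0 < R)
    (hInteg : ∀ n : ℕ, Integrable (fun t : ℝ => t ^ n * Real.exp (x1 * t)) ν)
    (hb : ∀ n : ℕ, ∫ t : ℝ, t ^ (2 * n) * Real.exp (x1 * t) ∂ν
      ≤ C * (2 * n).factorial / R ^ (2 * n))
    (s : ℝ) (hs : |s| < R) : Integrable (fun t : ℝ => Real.exp ((x1 + s) * t)) ν := by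
  have key : Integrable (fun t : ℝ => 2 * (Real.cosh (s * t) * Real.exp (x1 * t))) ν := by
    refine Integrable.const_mul ?_ 2
    refine ⟨by fun_prop, ?_⟩
    rw [hasFiniteIntegral_iff_ofReal (ae_of_all _ fun t => by positivity)]
    have e1 : ∀ t : ℝ, ENNReal.ofReal (Real.cosh (s * t) * Real.exp (x1 * t)) =
        ∑' n : ℕ, ENNReal.ofReal
          (s ^ (2 * n) / (2 * n).factorial * (t ^ (2 * n) * Real.exp (x1 * t))) := by
      intro t
      have h := (Real.hasSum_cosh (s * t)).mul_right (Real.exp (x1 * t))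
      rw [← h.tsum_eq, ENNReal.ofReal_tsum_of_nonneg _ h.summable]
      · congr 1; ext n; congr 1; rw [mul_pow]; ring
      · intro n
        have : 0 ≤ (s * t) ^ (2 * n) := by rw [pow_mul]; positivity
        positivity
    simp_rw [e1]
    rw [lintegral_tsum (fun n => by fun_prop)]
    have hnn : ∀ n : ℕ, ∀ t : ℝ,
        0 ≤ s ^ (2 * n) / (2 * n).factorial * (t ^ (2 * n) * Real.exp (x1 * t)) := by
      intro n t
      have : 0 ≤ s ^ (2 * n) := by rw [pow_mul]; positivity
      have : 0 ≤ t ^ (2 * n) := by rw [pow_mul]; positivity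
      positivity
    have e2 : ∀ n : ℕ, ∫⁻ t : ℝ, ENNReal.ofReal
          (s ^ (2 * n) / (2 * n).factorial * (t ^ (2 * n) * Real.exp (x1 * t))) ∂ν ≤
        ENNReal.ofReal (C * ((s / R) ^ 2) ^ n) := by
      intro n
      rw [← ofReal_integral_eq_lintegral_ofReal ((hInteg (2 * n)).const_mul _)
        (ae_of_all _ (hnn n))]
      apply ENNReal.ofReal_le_ofReal
      rw [integral_const_mul]
      have h0 : 0 ≤ s ^ (2 * n) := by rw [pow_mul]; positivity
      calc _ ≤ s ^ (2 * n) / (2 * n).factorial * (C * (2 * n).factorial / R ^ (2 * n)) :=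
            mul_le_mul_of_nonneg_left (hb n) (by positivity)
        _ = C * ((s / R) ^ 2) ^ n := by
            rw [← pow_mul, div_pow]
            have : ((2 * n).factorial : ℝ) ≠ 0 := by positivity
            field_simp
    refine lt_of_le_of_lt (ENNReal.tsum_le_tsum e2) ?_
    have hC : 0 ≤ C := by
      have h1 := hb 0
      have h2 : 0 ≤ ∫ t : ℝ, t ^ (2 * 0) * Real.exp (x1 * t) ∂ν :=
        integral_nonneg fun t => by simp; positivity
      simp at h1 h2
      linarith
    have hq : (s / R) ^ 2 < 1 := by
      rw [div_pow, div_lt_one (by positivity)]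
      exact sq_lt_sq' (by linarith [abs_lt.1 hs]) (abs_lt.1 hs).2
    have hsum : Summable fun n : ℕ => C * ((s / R) ^ 2) ^ n :=
      (summable_geometric_of_lt_one (by positivity) hq).mul_left C
    exact hsum.tsum_ofReal_lt_top
  refine key.mono' (by fun_prop) (ae_of_all _ fun t => ?_)
  rw [Real.norm_of_nonneg (by positivity), add_mul, Real.exp_add, Real.cosh_eq]
  have := Real.exp_pos (x1 * t)
  have := Real.exp_pos (-(s * t))
  have := Real.exp_pos (s * t)
  nlinarith [mul_pos ‹0 < Real.exp (x1 * t)› ‹0 < Real.exp (-(s * t))›]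

lemma strip_preconn {U : Set ℝ} (hU : Convex ℝ U) : IsPreconnected (Complex.re ⁻¹' U) :=
  (hU.linear_preimage Complex.reLm).isPreconnected

lemma strip_open {U : Set ℝ} (hU : IsOpen U) : IsOpen (Complex.re ⁻¹' U) :=
  hU.preimage Complex.continuous_re

/-- Cauchy estimate on a strip. -/
lemma cauchy_strip {U : Set ℝ} {g : ℂ → ℂ} (hg : DifferentiableOn ℂ g (Complex.re ⁻¹' U))
    {x1 R : ℝ} (hR : 0 < R) (hsub : Metric.closedBall x1 R ⊆ U) :
    ∃ C : ℝ, ∀ n : ℕ, ‖iteratedDeriv n g (x1 : ℂ)‖ ≤ C * n.factorial / R ^ n := by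
  have hs : Metric.closedBall (x1 : ℂ) R ⊆ Complex.re ⁻¹' U := by
    intro z hz
    apply hsub
    rw [Metric.mem_closedBall, Real.dist_eq] at *
    rw [Complex.dist_eq] at hz
    refine le_trans ?_ hz
    simpa using Complex.abs_re_le_norm (z - x1)
  obtain ⟨C, hC⟩ := (isCompact_closedBall (x1 : ℂ) R).exists_bound_of_continuousOn
    (hg.mono hs).continuousOn
  refine ⟨C, fun n => ?_⟩
  rw [mul_comm C]
  apply Complex.norm_iteratedDeriv_le_of_forall_mem_sphere_norm_le n hR
  · apply DifferentiableOn.diffContOnCl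
    rw [closure_ball _ hR.ne']
    exact hg.mono hs
  · intro z hz
    exact hC z (Metric.sphere_subset_closedBall hz)

open ProbabilityTheory in
lemma strip_extension {U : Set ℝ} (hUo : IsOpen U) (hUc : Convex ℝ U) {g : ℂ → ℂ}
    (hg : DifferentiableOn ℂ g (Complex.re ⁻¹' U)) (ν : Measure ℝ) {x0 : ℝ} (hx0 : x0 ∈ U)
    (hJ : x0 ∈ interior (integrableExpSet id ν))
    (heq : complexMGF id ν =ᶠ[𝓝 (x0 : ℂ)] g) :
    U ⊆ interior (integrableExpSet id ν) ∧ EqOn (complexMGF id ν) g (Complex.re ⁻¹' U) := by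
  set J := interior (integrableExpSet id ν) with hJdef
  have hJc : Convex ℝ J := convex_integrableExpSet.interior
  have hJo : IsOpen J := isOpen_interior
  have hEq : EqOn (complexMGF id ν) g (Complex.re ⁻¹' (U ∩ J)) := by
    refine AnalyticOnNhd.eqOn_of_preconnected_of_eventuallyEq (𝕜 := ℂ) (z₀ := (x0 : ℂ)) ?_ ?_
      (strip_preconn (hUc.inter hJc)) (by simpa using ⟨hx0, hJ⟩) heq
    · exact analyticOnNhd_complexMGF.mono fun z hz => hz.2
    · exact (hg.analyticOnNhd (strip_open hUo)).mono fun z hz => hz.1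
  have hsub : U ⊆ J := by
    refine hUc.isPreconnected.subset_of_closure_inter_subset hJo ⟨x0, hx0, hJ⟩ ?_
    rintro β ⟨hβ, hβU⟩
    obtain ⟨ε, hε, hball⟩ := Metric.isOpen_iff.1 hUo β hβU
    obtain ⟨x1, hx1, hd⟩ := Metric.mem_closure_iff.1 hβ (ε / 4) (by positivity)
    have hcb : Metric.closedBall x1 (ε / 2) ⊆ U := by
      refine subset_trans (fun z hz => ?_) hball
      rw [Metric.mem_closedBall] at hz
      rw [Metric.mem_ball]
      have := dist_triangle z x1 β
      rw [dist_comm x1 β] at this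
      linarith
    have hx1U : x1 ∈ U := hcb (Metric.mem_closedBall_self (by positivity))
    obtain ⟨C, hC⟩ := cauchy_strip hg (half_pos hε) hcb
    have hexp := expInt_aux ν x1 (ε / 2) C (half_pos hε)
      (fun n => integrable_pow_mul_exp_of_mem_interior_integrableExpSet (X := id) hx1 n) ?_
    · rw [hJdef, mem_interior_iff_mem_nhds]
      have : Metric.ball x1 (ε / 2) ∈ 𝓝 β := by
        apply Metric.isOpen_ball.mem_nhds
        rw [Metric.mem_ball]; linarith
      filter_upwards [this] with y hy
      have := hexp (y - x1) (by simpa [Real.dist_eq] using hy)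
      simpa [integrableExpSet] using this
    · intro n
      have he : complexMGF id ν =ᶠ[𝓝 (x1 : ℂ)] g := by
        filter_upwards [(strip_open (hUo.inter hJo)).mem_nhds
          (show (x1 : ℂ) ∈ Complex.re ⁻¹' (U ∩ J) by simpa using ⟨hx1U, hx1⟩)] with z hz
        exact hEq hz
      have h1 := hC (2 * n)
      rw [← he.iteratedDeriv_eq, iteratedDeriv_complexMGF (by simpa using hx1)] at h1
      refine le_trans ?_ h1
      refine le_trans (le_abs_self _) ?_
      rw [← Real.norm_eq_abs, ← Complex.norm_real, ← integral_complex_ofReal]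
      simp
  refine ⟨hsub, ?_⟩
  rwa [inter_eq_left.2 hsub] at hEq

open Polynomial in
lemma nonneg_isSumSq : ∀ (n : ℕ) (p : ℝ[X]), p.natDegree ≤ n → (∀ t, 0 ≤ p.eval t) →
    IsSumSq p := by
  intro n
  induction n using Nat.strong_induction_on with
  | _ n ih =>
  intro p hpn hp
  by_cases h0 : p.natDegree = 0
  · rw [Polynomial.eq_C_of_natDegree_eq_zero h0] at hp ⊢
    have h := hp 0
    rw [eval_C] at h
    rw [← Real.mul_self_sqrt h, C_mul]
    exact IsSumSq.mul_self _
  have hpne : p ≠ 0 := by rintro rfl; simp at h0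
  obtain ⟨z, hz⟩ := IsAlgClosed.exists_aeval_eq_zero ℂ p
    (by rw [Polynomial.degree_eq_natDegree hpne]; exact_mod_cast h0)
  by_cases him : z.im = 0
  · have hroot : p.IsRoot z.re := by
      have hzr : z = ((z.re : ℝ) : ℂ) := by apply Complex.ext <;> simp [him]
      rw [hzr] at hz
      have := Polynomial.aeval_algebraMap_apply ℂ z.re p
      simp only [Complex.coe_algebraMap] at this
      rw [this] at hz
      simpa using hz
    set r := z.re
    obtain ⟨q, hq⟩ := dvd_iff_isRoot.2 hroot
    have hev : ∀ t, p.eval t = (t - r) * q.eval t := fun t => by rw [hq]; simp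
    have hq1 : ∀ t, r < t → 0 ≤ q.eval t := fun t ht => by
      have := hp t
      rw [hev] at this
      exact nonneg_of_mul_nonneg_right this (by linarith)
    have hq2 : ∀ t, t < r → q.eval t ≤ 0 := fun t ht => by
      have := hp t
      rw [hev] at this
      by_contra hcon
      push Not at hcon
      nlinarith
    have hcont : ContinuousAt (fun t => q.eval t) r := q.continuous.continuousAt
    have hqr : q.IsRoot r := by
      apply le_antisymm
      · refine le_of_tendsto (hcont.mono_left (nhdsWithin_le_nhds (s := Iio r))) ?_
        filter_upwards [self_mem_nhdsWithin] with t ht using hq2 t ht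
      · refine ge_of_tendsto (hcont.mono_left (nhdsWithin_le_nhds (s := Ioi r))) ?_
        filter_upwards [self_mem_nhdsWithin] with t ht using hq1 t ht
    obtain ⟨s, hs⟩ := dvd_iff_isRoot.2 hqr
    have hps : p = ((X - C r) * (X - C r)) * s := by rw [hq, hs]; ring
    have hs0 : s ≠ 0 := by rintro rfl; simp at hps; exact hpne hps
    have hsn : ∀ t, t ≠ r → 0 ≤ s.eval t := fun t ht => by
      have := hp t
      rw [hps] at this
      simp only [eval_mul, eval_sub, eval_X, eval_C] at this
      exact nonneg_of_mul_nonneg_right this (mul_self_pos.2 (sub_ne_zero.2 ht))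
    have hsr : 0 ≤ s.eval r := by
      have hcont : ContinuousAt (fun t => s.eval t) r := s.continuous.continuousAt
      refine ge_of_tendsto (hcont.mono_left (nhdsWithin_le_nhds (s := Ioi r))) ?_
      filter_upwards [self_mem_nhdsWithin] with t ht using hsn t (ne_of_gt ht)
    have hdeg : s.natDegree < n := by
      refine lt_of_lt_of_le ?_ hpn
      rw [hps, natDegree_mul (mul_ne_zero (X_sub_C_ne_zero r) (X_sub_C_ne_zero r)) hs0,
        natDegree_mul (X_sub_C_ne_zero r) (X_sub_C_ne_zero r), natDegree_X_sub_C]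
      omega
    rw [hps]
    refine (IsSumSq.mul_self _).mul (ih _ hdeg s le_rfl fun t => ?_)
    by_cases ht : t = r
    · rw [ht]; exact hsr
    · exact hsn t ht
  · obtain ⟨q, hq⟩ := quadratic_dvd_of_aeval_eq_zero_im_ne_zero p hz him
    have hQ : (X ^ 2 - C (2 * z.re) * X + C (‖z‖ ^ 2) : ℝ[X]) =
        (X - C z.re) * (X - C z.re) + C z.im * C z.im := by
      rw [Complex.sq_norm, Complex.normSq_apply]
      simp only [map_add, map_mul, map_ofNat]
      ring
    have hqne : q ≠ 0 := by rintro rfl; simp at hq; exact hpne hq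
    have hQdeg : (X ^ 2 - C (2 * z.re) * X + C (‖z‖ ^ 2) : ℝ[X]).natDegree = 2 := by
      compute_degree!
    have hQne : (X ^ 2 - C (2 * z.re) * X + C (‖z‖ ^ 2) : ℝ[X]) ≠ 0 := by
      intro h; rw [h] at hQdeg; simp at hQdeg
    have hdeg : q.natDegree < n := by
      refine lt_of_lt_of_le ?_ hpn
      rw [hq, natDegree_mul hQne hqne, hQdeg]
      omega
    rw [hQ] at hq
    rw [hq]
    refine ((IsSumSq.mul_self _).add (IsSumSq.mul_self _)).mul (ih _ hdeg q le_rfl fun t => ?_)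
    have := hp t
    rw [hq] at this
    simp only [eval_mul, eval_add, eval_sub, eval_X, eval_C] at this
    refine nonneg_of_mul_nonneg_right this ?_
    have := mul_self_pos.2 him
    nlinarith [mul_self_nonneg (t - z.re)]

lemma IsSumSq.map_nonneg' {L : Polynomial ℝ →ₗ[ℝ] ℝ} (hL : ∀ p, 0 ≤ L (p * p))
    {p : Polynomial ℝ} (hp : IsSumSq p) : 0 ≤ L p := by
  induction hp with
  | zero => simp
  | sq_add a _ ih => rw [map_add]; exact add_nonneg (hL a) ih

/-- Functions of polynomial growth. -/
def polyGrowth : Submodule ℝ (ℝ → ℝ) where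
  carrier := {f | ∃ p : Polynomial ℝ, ∀ t, |f t| ≤ p.eval t}
  add_mem' := by
    rintro f g ⟨p, hp⟩ ⟨q, hq⟩
    refine ⟨p + q, fun t => ?_⟩
    rw [Polynomial.eval_add]
    exact (abs_add_le _ _).trans (add_le_add (hp t) (hq t))
  zero_mem' := ⟨0, fun t => by simp⟩
  smul_mem' := by
    rintro c f ⟨p, hp⟩
    refine ⟨Polynomial.C |c| * p, fun t => ?_⟩
    simp only [Pi.smul_apply, smul_eq_mul, abs_mul, Polynomial.eval_mul, Polynomial.eval_C]
    exact mul_le_mul_of_nonneg_left (hp t) (abs_nonneg c)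

/-- Polynomials as functions of polynomial growth. -/
def polyToGrowth : Polynomial ℝ →ₗ[ℝ] polyGrowth where
  toFun p := ⟨fun t => p.eval t, ⟨p ^ 2 + 1, fun t => by
    simp only [Polynomial.eval_add, Polynomial.eval_pow, Polynomial.eval_one]
    rw [abs_le]
    constructor <;> nlinarith [sq_nonneg (p.eval t - 1), sq_nonneg (p.eval t + 1)]⟩⟩
  map_add' p q := by ext t; simp
  map_smul' c p := by ext t; simp

lemma polyToGrowth_inj : Function.Injective polyToGrowth := by
  intro p q h
  apply Polynomial.funext
  intro t
  exact congrFun (congrArg Subtype.val h) t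

/-- The cone of nonnegative functions of polynomial growth. -/
def growthCone : PointedCone ℝ polyGrowth where
  carrier := {f | ∀ t, 0 ≤ f.1 t}
  add_mem' := by
    intro f g hf hg t
    exact add_nonneg (hf t) (hg t)
  zero_mem' := fun t => le_rfl
  smul_mem' := by
    intro c f hf t
    exact mul_nonneg c.2 (hf t)

lemma exists_extension (L : Polynomial ℝ →ₗ[ℝ] ℝ) (hL : ∀ p, 0 ≤ L (p * p)) :
    ∃ G : polyGrowth →ₗ[ℝ] ℝ, (∀ p, G (polyToGrowth p) = L p) ∧
      ∀ f : polyGrowth, (∀ t, 0 ≤ f.1 t) → 0 ≤ G f := by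
  let e := LinearEquiv.ofInjective polyToGrowth polyToGrowth_inj
  let F : polyGrowth →ₗ.[ℝ] ℝ := ⟨LinearMap.range polyToGrowth, L.comp e.symm.toLinearMap⟩
  have h1 : ∀ x : F.domain, (x : polyGrowth) ∈ growthCone → 0 ≤ F x := by
    intro x hx
    obtain ⟨p, rfl⟩ := e.surjective x
    change 0 ≤ L (e.symm (e p))
    rw [e.symm_apply_apply]
    exact (nonneg_isSumSq _ p le_rfl hx).map_nonneg' hL
  have h2 : ∀ y, ∃ x : F.domain, (x : polyGrowth) + y ∈ growthCone := by
    rintro ⟨y, p, hp⟩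
    refine ⟨e p, fun t => ?_⟩
    change 0 ≤ p.eval t + y t
    have := abs_le.1 (hp t)
    linarith
  obtain ⟨G, hG1, hG2⟩ := riesz_extension growthCone F h1 h2
  refine ⟨G, fun p => ?_, hG2⟩
  have := hG1 (e p)
  refine this.trans ?_
  change L (e.symm (e p)) = L p
  rw [e.symm_apply_apply]

/-- A trapezoid cutoff. -/
def cutoff (k : ℝ) (t : ℝ) : ℝ := max 0 (min 1 (k + 1 - |t|))

lemma cutoff_cont (k : ℝ) : Continuous (cutoff k) := by unfold cutoff; fun_prop

lemma cutoff_nonneg (k t : ℝ) : 0 ≤ cutoff k t := le_max_left _ _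

lemma cutoff_le_one (k t : ℝ) : cutoff k t ≤ 1 := max_le zero_le_one (min_le_left _ _)

lemma cutoff_eq_one {k t : ℝ} (h : |t| ≤ k) : cutoff k t = 1 := by
  unfold cutoff
  rw [min_eq_left (by linarith), max_eq_right zero_le_one]

lemma cutoff_eq_zero {k t : ℝ} (h : k + 1 ≤ |t|) : cutoff k t = 0 := by
  unfold cutoff
  exact max_eq_left ((min_le_right _ _).trans (by linarith))

open CompactlySupported in
/-- Truncated monomial. -/
def truncMono (n : ℕ) (k : ℝ) : C_c(ℝ, ℝ) where
  toFun t := t ^ n * cutoff k t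
  continuous_toFun := (continuous_pow n).mul (cutoff_cont k)
  hasCompactSupport' := by
    refine HasCompactSupport.intro (isCompact_closedBall (0 : ℝ) (k + 1)) fun t ht => ?_
    rw [Metric.mem_closedBall, dist_zero_right, Real.norm_eq_abs, not_le] at ht
    rw [cutoff_eq_zero ht.le, mul_zero]

lemma growth_of_bdd {f : ℝ → ℝ} {M : ℝ} (h : ∀ t, |f t| ≤ M) : f ∈ polyGrowth :=
  ⟨Polynomial.C M, fun t => by simpa using h t⟩

open CompactlySupported in
lemma growth_of_cc (f : C_c(ℝ, ℝ)) : (f : ℝ → ℝ) ∈ polyGrowth := by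
  obtain ⟨M, hM⟩ := f.hasCompactSupport.exists_bound_of_continuous f.continuous
  exact growth_of_bdd (M := M) hM

open CompactlySupported in
/-- The inclusion of compactly supported functions. -/
def ccToGrowth : C_c(ℝ, ℝ) →ₗ[ℝ] polyGrowth where
  toFun f := ⟨f, growth_of_cc f⟩
  map_add' f g := by ext t; rfl
  map_smul' c f := by ext t; rfl

lemma hamburger (L : Polynomial ℝ →ₗ[ℝ] ℝ) (hL : ∀ p, 0 ≤ L (p * p)) :
    ∃ ν : Measure ℝ, ∀ n : ℕ, Integrable (fun t : ℝ => t ^ n) ν ∧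
      ∫ t : ℝ, t ^ n ∂ν = L (Polynomial.X ^ n) := by
  obtain ⟨G, hG1, hG2⟩ := exists_extension L hL
  let Λ : CompactlySupportedContinuousMap ℝ ℝ →ₚ[ℝ] ℝ :=
    PositiveLinearMap.mk₀ (G.comp ccToGrowth) fun f hf => hG2 _ fun t => hf t
  let ν := RealRMK.rieszMeasure Λ
  have hν : ∀ f : CompactlySupportedContinuousMap ℝ ℝ, ∫ t, f t ∂ν = G (ccToGrowth f) :=
    fun f => RealRMK.integral_rieszMeasure Λ f
  have hmono : ∀ f g : polyGrowth, (∀ t, f.1 t ≤ g.1 t) → G f ≤ G g := by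
    intro f g h
    have := hG2 (g - f) fun t => sub_nonneg.2 (h t)
    rw [map_sub] at this
    linarith
  have htr : ∀ n k, ∫ t, t ^ n * cutoff k t ∂ν = G (ccToGrowth (truncMono n k)) :=
    fun n k => hν (truncMono n k)
  have htri : ∀ n k, Integrable (fun t => t ^ n * cutoff k t) ν := fun n k =>
    (truncMono n k).continuous.integrable_of_hasCompactSupport (truncMono n k).hasCompactSupport
  have heven : ∀ n, Integrable (fun t : ℝ => t ^ (2 * n)) ν := by
    intro n
    have hnn : ∀ t : ℝ, 0 ≤ t ^ (2 * n) := fun t => by rw [pow_mul]; positivity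
    refine (aecover_closedBall (x := (0 : ℝ)) (μ := ν)
      (tendsto_natCast_atTop_atTop (R := ℝ))).integrable_of_integral_norm_bounded
      (L (Polynomial.X ^ (2 * n))) ?_ ?_
    · intro k
      exact (continuous_pow (2 * n)).continuousOn.integrableOn_compact (isCompact_closedBall _ _)
    · refine Eventually.of_forall fun k => ?_
      have h1 : ∫ t in Metric.closedBall (0 : ℝ) k, ‖t ^ (2 * n)‖ ∂ν =
          ∫ t in Metric.closedBall (0 : ℝ) k, t ^ (2 * n) * cutoff k t ∂ν := by
        refine setIntegral_congr_fun Metric.isClosed_closedBall.measurableSet fun t ht => ?_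
        rw [Metric.mem_closedBall, dist_zero_right, Real.norm_eq_abs] at ht
        simp only [cutoff_eq_one ht, mul_one, Real.norm_of_nonneg (hnn t)]
      rw [h1]
      refine (setIntegral_le_integral (htri _ _)
        (ae_of_all _ fun t => mul_nonneg (hnn t) (cutoff_nonneg _ _))).trans ?_
      rw [htr, ← hG1]
      apply hmono
      intro t
      change t ^ (2 * n) * cutoff k t ≤ (Polynomial.X ^ (2 * n)).eval t
      simp only [Polynomial.eval_pow, Polynomial.eval_X]
      exact mul_le_of_le_one_right (hnn t) (cutoff_le_one _ _)
  have hInteg : ∀ n, Integrable (fun t : ℝ => t ^ n) ν := by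
    intro n
    refine ((heven 0).add (heven n)).mono' (by fun_prop) (ae_of_all _ fun t => ?_)
    simp only [Pi.add_apply, mul_zero, pow_zero, Real.norm_eq_abs]
    rw [mul_comm 2 n, pow_mul, abs_le]
    constructor <;> nlinarith [sq_nonneg (t ^ n - 1), sq_nonneg (t ^ n + 1)]
  refine ⟨ν, fun n => ⟨hInteg n, ?_⟩⟩
  have lim1 : Tendsto (fun k : ℕ => ∫ t, t ^ n * cutoff k t ∂ν) atTop (𝓝 (∫ t, t ^ n ∂ν)) := by
    refine tendsto_integral_of_dominated_convergence (fun t => ‖t ^ n‖) (fun k => ?_)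
      (hInteg n).norm (fun k => ae_of_all _ fun t => ?_) (ae_of_all _ fun t => ?_)
    · exact (htri n k).aestronglyMeasurable
    · rw [norm_mul, Real.norm_of_nonneg (cutoff_nonneg _ _)]
      exact mul_le_of_le_one_right (norm_nonneg _) (cutoff_le_one _ _)
    · refine tendsto_const_nhds.congr' ?_
      obtain ⟨K, hK⟩ := exists_nat_ge |t|
      filter_upwards [eventually_ge_atTop K] with k hk
      rw [cutoff_eq_one (hK.trans (by exact_mod_cast hk)), mul_one]
  have hb : ∀ k : ℕ, 1 ≤ k → |(∫ t, t ^ n * cutoff k t ∂ν) - L (Polynomial.X ^ n)| ≤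
      L (Polynomial.X ^ (2 * n + 2)) * (k : ℝ)⁻¹ := by
    intro k hk
    have hk' : (1 : ℝ) ≤ k := by exact_mod_cast hk
    have hpt : ∀ t : ℝ, |t ^ n * cutoff k t - t ^ n| ≤ (k : ℝ)⁻¹ * t ^ (2 * n + 2) := by
      intro t
      by_cases ht : |t| ≤ k
      · rw [cutoff_eq_one ht, mul_one, sub_self, abs_zero]
        have : 0 ≤ t ^ (2 * n + 2) := by
          rw [show 2 * n + 2 = 2 * (n + 1) by ring, pow_mul]; positivity
        positivity
      · push Not at ht
        have h1 : |t ^ n * cutoff k t - t ^ n| ≤ |t| ^ n := by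
          rw [show t ^ n * cutoff k t - t ^ n = t ^ n * (cutoff k t - 1) by ring, abs_mul, abs_pow]
          apply mul_le_of_le_one_right (by positivity)
          rw [abs_le]
          constructor <;> linarith [cutoff_nonneg k t, cutoff_le_one k t]
        refine h1.trans ?_
        rw [inv_mul_eq_div, le_div_iff₀ (by linarith)]
        have e : t ^ (2 * n + 2) = |t| ^ n * |t| ^ (n + 2) := by
          rw [← pow_add, show 2 * n + 2 = 2 * (n + 1) by ring,
            show n + (n + 2) = 2 * (n + 1) by ring, pow_mul, pow_mul, sq_abs]
        rw [e]
        refine mul_le_mul_of_nonneg_left ?_ (by positivity)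
        calc (k : ℝ) ≤ |t| := ht.le
          _ = |t| ^ 1 := (pow_one _).symm
          _ ≤ |t| ^ (n + 2) := pow_le_pow_right₀ (by linarith) (by omega)
    rw [htr, ← hG1, ← map_sub, mul_comm, ← smul_eq_mul, ← hG1, ← map_smul, abs_le, ← map_neg]
    constructor
    · apply hmono
      intro t
      have := (abs_le.1 (hpt t)).1
      simpa [polyToGrowth, ccToGrowth, truncMono] using this
    · apply hmono
      intro t
      have := (abs_le.1 (hpt t)).2
      simpa [polyToGrowth, ccToGrowth, truncMono] using this
  have lim2 : Tendsto (fun k : ℕ => ∫ t, t ^ n * cutoff k t ∂ν) atTop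
      (𝓝 (L (Polynomial.X ^ n))) := by
    rw [tendsto_iff_norm_sub_tendsto_zero]
    refine squeeze_zero' (Eventually.of_forall fun k => norm_nonneg _)
      (g := fun k : ℕ => L (Polynomial.X ^ (2 * n + 2)) * (k : ℝ)⁻¹) ?_ ?_
    · filter_upwards [eventually_ge_atTop 1] with k hk using hb k hk
    · simpa using (tendsto_inv_atTop_nhds_zero_nat (𝕜 := ℝ)).const_mul
        (L (Polynomial.X ^ (2 * n + 2)))
  exact tendsto_nhds_unique lim1 lim2

/-- The complex moment functional attached to a sequence. -/
def momFun (m : ℕ → ℂ) : Polynomial ℝ →ₗ[ℝ] ℂ :=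
  Polynomial.lsum fun n => LinearMap.toSpanSingleton ℝ ℂ (m n)

lemma momFun_eq (m : ℕ → ℂ) (p : Polynomial ℝ) (N : ℕ) (h : p.natDegree < N) :
    momFun m p = ∑ n ∈ Finset.range N, (p.coeff n : ℂ) * m n := by
  rw [momFun, Polynomial.lsum_apply, Polynomial.sum_over_range' _ (by simp) N h]
  simp [LinearMap.toSpanSingleton_apply]

lemma momFun_X_pow (m : ℕ → ℂ) (n : ℕ) : momFun m (Polynomial.X ^ n) = m n := by
  rw [momFun_eq m _ (n + 1) (by simp)]
  rw [Finset.sum_eq_single n]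
  · simp
  · intro k _ hk
    simp [Polynomial.coeff_X_pow, hk]
  · simp

lemma taylor_isBigO {g : ℂ → ℂ} {x0 : ℂ} (hg : AnalyticAt ℂ g x0) (D : ℕ) :
    (fun w : ℂ => g (x0 + w) - ∑ n ∈ Finset.range D, iteratedDeriv n g x0 / n.factorial * w ^ n)
      =O[𝓝 0] fun w => ‖w‖ ^ D := by
  have := hg.hasFPowerSeriesAt.isBigO_sub_partialSum_pow D
  simpa [FormalMultilinearSeries.partialSum, FormalMultilinearSeries.ofScalars_apply_eq,
    mul_comm] using this

lemma exists_weights (D : ℕ) : ∃ β : Fin D → Fin D → ℂ, ∀ j i : Fin D,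
    ∑ k, β j k * ((k : ℕ) : ℂ) ^ (i : ℕ) = if j = i then 1 else 0 := by
  let V : Matrix (Fin D) (Fin D) ℂ := Matrix.vandermonde fun k : Fin D => ((k : ℕ) : ℂ)
  have hV : IsUnit V.det := by
    rw [isUnit_iff_ne_zero, Matrix.det_vandermonde_ne_zero_iff]
    intro k l h
    have h' : ((k : ℕ) : ℂ) = ((l : ℕ) : ℂ) := h
    exact Fin.ext (by exact_mod_cast h')
  refine ⟨fun j k => (V⁻¹ : Matrix (Fin D) (Fin D) ℂ) j k, fun j i => ?_⟩
  have h := congrFun (congrFun (Matrix.nonsing_inv_mul V hV) j) i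
  rw [Matrix.mul_apply, Matrix.one_apply] at h
  exact h

lemma poly_part {ι : Type*} [Fintype ι] (D : ℕ) (m : ℕ → ℂ) (u ξ : ι → ℂ) (c : ℕ → ℝ)
    (hA : ∀ i < D, ∑ k, ξ k * u k ^ i = (i.factorial : ℂ) * c i) :
    ∑ k, ∑ l, (∑ n ∈ Finset.range D, m n / n.factorial * (u k + (starRingEnd ℂ) (u l)) ^ n)
      * ξ k * (starRingEnd ℂ) (ξ l) =
    ∑ n ∈ Finset.range D, m n * ∑ x ∈ Finset.HasAntidiagonal.antidiagonal n, (c x.1 : ℂ) * c x.2 := by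
  have h1 : ∀ k l, (∑ n ∈ Finset.range D, m n / n.factorial * (u k + (starRingEnd ℂ) (u l)) ^ n)
      * ξ k * (starRingEnd ℂ) (ξ l) = ∑ n ∈ Finset.range D, ∑ x ∈ Finset.HasAntidiagonal.antidiagonal n,
        m n / n.factorial * n.choose x.1 *
          ((ξ k * u k ^ x.1) * (starRingEnd ℂ) (ξ l * u l ^ x.2)) := by
    intro k l
    rw [Finset.sum_mul, Finset.sum_mul]
    refine Finset.sum_congr rfl fun n _ => ?_
    rw [(Commute.all _ _).add_pow', Finset.mul_sum, Finset.sum_mul, Finset.sum_mul]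
    refine Finset.sum_congr rfl fun x _ => ?_
    simp only [nsmul_eq_mul, map_mul, map_pow]
    ring
  simp_rw [h1]
  rw [Finset.sum_congr rfl fun k _ => Finset.sum_comm, Finset.sum_comm]
  refine Finset.sum_congr rfl fun n hn => ?_
  rw [Finset.sum_congr rfl fun k _ => Finset.sum_comm, Finset.sum_comm, Finset.mul_sum]
  refine Finset.sum_congr rfl fun x hx => ?_
  rw [Finset.HasAntidiagonal.mem_antidiagonal] at hx
  rw [Finset.mem_range] at hn
  simp_rw [← Finset.mul_sum]
  rw [← Finset.sum_mul, ← map_sum, hA x.1 (by omega), hA x.2 (by omega)]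
  have h2 : (n.choose x.1 : ℂ) * x.1.factorial * x.2.factorial = n.factorial := by
    have := Nat.add_choose_mul_factorial_mul_factorial x.2 x.1
    rw [add_comm, hx] at this
    rw [mul_right_comm]
    exact_mod_cast this
  have h3 : (n.factorial : ℂ) ≠ 0 := by exact_mod_cast n.factorial_ne_zero
  simp only [map_mul, map_natCast, Complex.conj_ofReal]
  rw [div_mul_eq_mul_div, div_mul_eq_mul_div, div_eq_iff h3, ← h2]
  ring

lemma hankel_psd {g : ℂ → ℂ} {x0 : ℂ} (hg : AnalyticAt ℂ g x0) (α : ℂ) (hα : α ≠ 0)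
    (hPD : ∀ (n : ℕ) (s : Fin n → ℝ), ∀ᶠ h : ℝ in 𝓝[>] 0, ∀ ξ : Fin n → ℂ,
      0 ≤ ∑ k, ∑ l, g (x0 + h * (α * s k + (starRingEnd ℂ) α * s l)) * ξ k * (starRingEnd ℂ) (ξ l))
    (p : Polynomial ℝ) : 0 ≤ momFun (fun n => iteratedDeriv n g x0) (p * p) := by
  set N := p.natDegree with hN
  set D := 2 * N + 1 with hD
  set m : ℕ → ℂ := fun n => iteratedDeriv n g x0 with hm
  obtain ⟨β, hβ⟩ := exists_weights D
  let ξ : ℝ → Fin D → ℂ := fun h k =>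
    ∑ j : Fin D, (p.coeff j : ℂ) * (j : ℕ).factorial * ((α * h) ^ (j : ℕ))⁻¹ * β j k
  let s : Fin D → ℝ := fun k => (k : ℕ)
  let P : ℂ → ℂ := fun w => ∑ n ∈ Finset.range D, m n / n.factorial * w ^ n
  let w : Fin D → Fin D → ℂ := fun k l => α * s k + (starRingEnd ℂ) α * s l
  have hS : ∀ h : ℝ, 0 < h → ∑ k, ∑ l, P (h * w k l) * ξ h k * (starRingEnd ℂ) (ξ h l) =
      momFun m (p * p) := by
    intro h hh
    have hαh : α * h ≠ 0 := mul_ne_zero hα (by exact_mod_cast hh.ne')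
    rw [momFun_eq m _ D (by
      have := Polynomial.natDegree_mul_le (p := p) (q := p)
      omega)]
    have := poly_part D m (fun k : Fin D => α * h * (k : ℕ)) (ξ h) (fun j => p.coeff j) ?_
    · convert this using 1
      · refine Finset.sum_congr rfl fun k _ => Finset.sum_congr rfl fun l _ => ?_
        simp only [P, w, s]
        congr 3
        ext n
        congr 2
        simp
        ring
      · refine Finset.sum_congr rfl fun n _ => ?_
        rw [Polynomial.coeff_mul, mul_comm]
        push_cast
        rfl
    · intro i hi
      have h1 : ∀ k : Fin D, ξ h k * (α * h * (k : ℕ)) ^ i = ∑ j : Fin D,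
          (p.coeff j : ℂ) * (j : ℕ).factorial * ((α * h) ^ (j : ℕ))⁻¹ * (α * h) ^ i *
            (β j k * ((k : ℕ) : ℂ) ^ i) := by
        intro k
        simp only [ξ]
        rw [Finset.sum_mul]
        refine Finset.sum_congr rfl fun j _ => ?_
        rw [mul_pow]
        ring
      simp_rw [h1]
      rw [Finset.sum_comm]
      simp_rw [← Finset.mul_sum]
      have h2 := fun j => hβ j ⟨i, hi⟩
      simp only at h2
      simp_rw [h2]
      simp only [mul_ite, mul_one, mul_zero, Finset.sum_ite_eq', Finset.mem_univ, if_true]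
      rw [mul_assoc, inv_mul_cancel₀ (pow_ne_zero _ hαh), mul_one, mul_comm]
  have hξ : ∀ k, (fun h : ℝ => ξ h k) =O[𝓝[>] 0] fun h : ℝ => (h ^ N)⁻¹ := by
    intro k
    refine Asymptotics.IsBigO.fun_sum fun j _ => ?_
    by_cases hj : (j : ℕ) ≤ N
    · refine Asymptotics.IsBigO.of_bound
        ‖(p.coeff j : ℂ) * (j : ℕ).factorial * (α ^ (j : ℕ))⁻¹ * β j k‖ ?_
      filter_upwards [Ioo_mem_nhdsGT (show (0 : ℝ) < 1 by norm_num)] with h hh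
      have e : (p.coeff j : ℂ) * (j : ℕ).factorial * ((α * h) ^ (j : ℕ))⁻¹ * β j k =
        (p.coeff j : ℂ) * (j : ℕ).factorial * (α ^ (j : ℕ))⁻¹ * β j k *
          (((h ^ (j : ℕ))⁻¹ : ℝ) : ℂ) := by
        rw [mul_pow, mul_inv]
        push_cast
        ring
      rw [e, norm_mul]
      refine mul_le_mul_of_nonneg_left ?_ (norm_nonneg _)
      have h0 := hh.1
      rw [Complex.norm_real, Real.norm_of_nonneg (by positivity),
        Real.norm_of_nonneg (by positivity)]
      exact inv_anti₀ (by positivity) (pow_le_pow_of_le_one h0.le hh.2.le hj)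
    · have : p.coeff j = 0 := Polynomial.coeff_eq_zero_of_natDegree_lt (by omega)
      simp only [this]
      simpa using Asymptotics.isBigO_zero _ _
  have hR : ∀ k l, Tendsto (fun h : ℝ => (g (x0 + h * w k l) - P (h * w k l)) * ξ h k *
      (starRingEnd ℂ) (ξ h l)) (𝓝[>] 0) (𝓝 0) := by
    intro k l
    have hw : Tendsto (fun h : ℝ => (h : ℂ) * w k l) (𝓝[>] 0) (𝓝 0) := by
      have : ContinuousAt (fun h : ℝ => (h : ℂ) * w k l) 0 := by fun_prop
      have h2 := this.tendsto
      simp only [Complex.ofReal_zero, zero_mul] at h2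
      exact h2.mono_left nhdsWithin_le_nhds
    have h1 : (fun h : ℝ => g (x0 + h * w k l) - P (h * w k l)) =O[𝓝[>] 0]
        fun h : ℝ => h ^ D := by
      refine ((taylor_isBigO hg D).comp_tendsto hw).trans ?_
      refine Asymptotics.IsBigO.of_bound (‖w k l‖ ^ D) (Eventually.of_forall fun h => ?_)
      simp only [Function.comp, norm_mul, mul_pow, norm_pow, Complex.norm_real, norm_norm]
      rw [mul_comm]
    have h2 : (fun h : ℝ => (starRingEnd ℂ) (ξ h l)) =O[𝓝[>] 0] fun h : ℝ => (h ^ N)⁻¹ := by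
      have h5 := (hξ l).norm_left
      refine Asymptotics.IsBigO.of_norm_left (h5.congr_left fun h => ?_)
      exact (RCLike.norm_conj _).symm
    have h3 := (h1.mul (hξ k)).mul h2
    refine h3.trans_tendsto ?_
    have h4 : Tendsto (fun h : ℝ => h) (𝓝[>] 0) (𝓝 0) :=
      tendsto_id.mono_left nhdsWithin_le_nhds
    refine h4.congr' ?_
    filter_upwards [self_mem_nhdsWithin] with h hh
    have : h ≠ 0 := ne_of_gt hh
    rw [hD]
    field_simp
    ring
  have hlim : Tendsto (fun h : ℝ => ∑ k, ∑ l, g (x0 + h * w k l) * ξ h k *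
      (starRingEnd ℂ) (ξ h l)) (𝓝[>] 0) (𝓝 (momFun m (p * p))) := by
    have h1 : Tendsto (fun h : ℝ => (∑ k, ∑ l, (g (x0 + h * w k l) - P (h * w k l)) * ξ h k *
      (starRingEnd ℂ) (ξ h l)) + momFun m (p * p)) (𝓝[>] 0) (𝓝 (0 + momFun m (p * p))) := by
      refine Tendsto.add ?_ tendsto_const_nhds
      have := tendsto_finsetSum Finset.univ fun k _ =>
        tendsto_finsetSum Finset.univ fun l _ => hR k l
      simpa using this
    rw [zero_add] at h1
    refine h1.congr' ?_
    filter_upwards [self_mem_nhdsWithin] with h hh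
    rw [← hS h hh, ← Finset.sum_add_distrib]
    refine Finset.sum_congr rfl fun k _ => ?_
    rw [← Finset.sum_add_distrib]
    refine Finset.sum_congr rfl fun l _ => ?_
    ring
  refine ge_of_tendsto hlim ?_
  filter_upwards [hPD D s] with h hh
  exact hh (ξ h)

lemma exists_moment_measure {g : ℂ → ℂ} {x0 : ℂ}
    (h : ∀ p : Polynomial ℝ, 0 ≤ momFun (fun n => iteratedDeriv n g x0) (p * p)) :
    ∃ ν : Measure ℝ, ∀ n : ℕ, Integrable (fun t : ℝ => t ^ n) ν ∧
      ((∫ t : ℝ, t ^ n ∂ν : ℝ) : ℂ) = iteratedDeriv n g x0 := by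
  set Lc := momFun (fun n => iteratedDeriv n g x0) with hLc
  have him : ∀ q, (Lc q).im = 0 := by
    intro q
    have h1 := h (q + 1)
    have h2 := h (q - 1)
    have e : (q + 1) * (q + 1) = (q - 1) * (q - 1) + (4 : ℝ) • q := by
      have : (4 : ℝ) • q = 4 * q := by rw [Polynomial.smul_eq_C_mul]; rfl
      rw [this]; ring
    rw [e, map_add, map_smul, Complex.nonneg_iff] at h1
    rw [Complex.nonneg_iff] at h2
    have h3 := h1.2
    rw [Complex.add_im, ← h2.2, Complex.smul_im] at h3
    simp at h3
    exact h3
  obtain ⟨ν, hν⟩ := hamburger (Complex.reLm.comp Lc) (fun p => (Complex.nonneg_iff.1 (h p)).1)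
  refine ⟨ν, fun n => ⟨(hν n).1, ?_⟩⟩
  rw [(hν n).2]
  have : Lc (Polynomial.X ^ n) = iteratedDeriv n g x0 := momFun_X_pow _ n
  rw [← this]
  apply Complex.ext
  · simp
  · simp [him]

lemma vset_open (a b : EReal) (y0 : ℝ) :
    IsOpen {x : ℝ | a < ((y0 - x : ℝ) : EReal) ∧ ((y0 - x : ℝ) : EReal) < b} := by
  have : Continuous fun x : ℝ => ((y0 - x : ℝ) : EReal) :=
    continuous_coe_real_ereal.comp (by fun_prop)
  exact (isOpen_lt continuous_const this).inter (isOpen_lt this continuous_const)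

lemma vset_convex (a b : EReal) (y0 : ℝ) :
    Convex ℝ {x : ℝ | a < ((y0 - x : ℝ) : EReal) ∧ ((y0 - x : ℝ) : EReal) < b} := by
  refine Set.OrdConnected.convex ⟨fun x hx y hy z hz => ⟨?_, ?_⟩⟩
  · exact hy.1.trans_le (EReal.coe_le_coe_iff.2 (by linarith [hz.2]))
  · exact lt_of_le_of_lt (EReal.coe_le_coe_iff.2 (by linarith [hz.1])) hx.2

lemma wd_iff (ν : Measure ℝ) (y : ℝ) (F : ℝ → ℂ) :
    Integrable F (ν.withDensity fun t => ENNReal.ofReal (Real.exp (y * t))) ↔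
      Integrable (fun t : ℝ => Complex.exp (y * t) * F t) ν := by
  rw [integrable_withDensity_iff_integrable_smul' (by fun_prop) (by simp)]
  simp [ENNReal.toReal_ofReal (Real.exp_pos _).le]

lemma wd_int (ν : Measure ℝ) (y : ℝ) (F : ℝ → ℂ) :
    ∫ t, F t ∂(ν.withDensity fun t => ENNReal.ofReal (Real.exp (y * t))) =
      ∫ t : ℝ, Complex.exp (y * t) * F t ∂ν := by
  rw [integral_withDensity_eq_integral_toReal_smul (by fun_prop) (by simp)]
  simp [ENNReal.toReal_ofReal (Real.exp_pos _).le]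

lemma eventuallyEq_of_iteratedDeriv {f g : ℂ → ℂ} {x : ℂ} (hf : AnalyticAt ℂ f x)
    (hg : AnalyticAt ℂ g x) (h : ∀ n, iteratedDeriv n f x = iteratedDeriv n g x) :
    f =ᶠ[𝓝 x] g := by
  have h1 := hf.hasFPowerSeriesAt
  have h2 := hg.hasFPowerSeriesAt
  simp_rw [h] at h1
  have h3 := h1.sub h2
  rw [sub_self] at h3
  filter_upwards [h3.eventually_eq_zero] with z hz
  exact sub_eq_zero.1 hz

lemma core_rep (a b : EReal) (f : ℂ → ℂ) (hf : DifferentiableOn ℂ f (HStrip a b)) (y0 : ℝ)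
    (ha : a < (y0 : EReal)) (hb : (y0 : EReal) < b) (α : ℂ) (hα : α ≠ 0)
    (hPD : ∀ (n : ℕ) (s : Fin n → ℝ), ∀ᶠ h : ℝ in 𝓝[>] 0, ∀ ξ : Fin n → ℂ,
      0 ≤ ∑ k, ∑ l, f (y0 * I - I * (h * (α * s k + (starRingEnd ℂ) α * s l))) * ξ k *
        (starRingEnd ℂ) (ξ l)) :
    ∃ μ : Measure ℝ, ∀ z ∈ HStrip a b,
        Integrable (fun t : ℝ => Complex.exp (I * z * t)) μ ∧
        f z = ∫ t : ℝ, Complex.exp (I * z * t) ∂μ := by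
  set V : Set ℝ := {x : ℝ | a < ((y0 - x : ℝ) : EReal) ∧ ((y0 - x : ℝ) : EReal) < b} with hV
  have hVo : IsOpen V := vset_open a b y0
  have hVc : Convex ℝ V := vset_convex a b y0
  have h0V : (0 : ℝ) ∈ V := by simp only [hV, mem_ofPred_eq, sub_zero]; exact ⟨ha, hb⟩
  let g : ℂ → ℂ := fun w => f (y0 * I - I * w)
  have hg : DifferentiableOn ℂ g (Complex.re ⁻¹' V) := by
    refine hf.comp (by fun_prop) ?_
    intro w hw
    simpa [HStrip, hV] using hw
  have hga : AnalyticAt ℂ g ((0 : ℝ) : ℂ) :=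
    hg.analyticAt ((strip_open hVo).mem_nhds (by simpa using h0V))
  have hH := hankel_psd hga α hα (by
    intro n s
    filter_upwards [hPD n s] with h hh ξ
    have := hh ξ
    simpa [g] using this)
  obtain ⟨ν, hν⟩ := exists_moment_measure hH
  obtain ⟨R, hR, hsub⟩ := Metric.nhds_basis_closedBall.mem_iff.1 (hVo.mem_nhds h0V)
  obtain ⟨C, hC⟩ := cauchy_strip hg hR hsub
  have hexp : ∀ s : ℝ, |s| < R → Integrable (fun t : ℝ => Real.exp (s * t)) ν := by
    intro s hs
    have := expInt_aux ν 0 R C hR (by simpa using fun n => (hν n).1) (by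
      intro n
      have h1 := hC (2 * n)
      rw [← (hν (2 * n)).2, Complex.norm_real] at h1
      simpa using (le_abs_self _).trans h1) s hs
    simpa using this
  have hJ : (0 : ℝ) ∈ interior (ProbabilityTheory.integrableExpSet id ν) := by
    rw [mem_interior_iff_mem_nhds]
    filter_upwards [Metric.ball_mem_nhds (0 : ℝ) hR] with s hs
    rw [Metric.mem_ball, Real.dist_eq, sub_zero] at hs
    exact hexp s hs
  have hJ' : (((0 : ℝ) : ℂ)).re ∈ interior (ProbabilityTheory.integrableExpSet id ν) := by
    simpa using hJ
  have heq : ProbabilityTheory.complexMGF id ν =ᶠ[𝓝 ((0 : ℝ) : ℂ)] g := by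
    refine eventuallyEq_of_iteratedDeriv (ProbabilityTheory.analyticAt_complexMGF hJ') hga ?_
    intro n
    rw [ProbabilityTheory.iteratedDeriv_complexMGF hJ', ← (hν n).2, ← integral_complex_ofReal]
    simp
  obtain ⟨hVJ, hEq⟩ := strip_extension hVo hVc hg ν h0V hJ heq
  refine ⟨ν.withDensity fun t => ENNReal.ofReal (Real.exp (y0 * t)), fun z hz => ?_⟩
  have hw : I * z + y0 ∈ Complex.re ⁻¹' V := by
    have e : y0 - (I * z + y0).re = z.im := by simp
    change a < ((y0 - (I * z + y0).re : ℝ) : EReal) ∧ ((y0 - (I * z + y0).re : ℝ) : EReal) < b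
    rw [e]
    exact hz
  have hkey : ∀ t : ℝ, Complex.exp (y0 * t) * Complex.exp (I * z * t) =
      Complex.exp ((I * z + y0) * t) := by
    intro t
    rw [← Complex.exp_add]
    ring_nf
  rw [wd_iff, wd_int]
  simp_rw [hkey]
  constructor
  · have h0 : (I * z + y0).re ∈ ProbabilityTheory.integrableExpSet id ν :=
      interior_subset (hVJ hw)
    have h1 : Integrable (fun t : ℝ => Real.exp ((I * z + y0).re * t)) ν := h0
    refine h1.mono' (by fun_prop) (ae_of_all _ fun t => ?_)
    rw [Complex.norm_exp]
    simp
  · have h2 := hEq hw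
    simp only [ProbabilityTheory.complexMGF, id] at h2
    rw [h2]
    simp only [g]
    congr 1
    linear_combination z * Complex.I_mul_I

lemma rep_posDef (a b : EReal) (f : ℂ → ℂ) (μ : Measure ℝ)
    (h : ∀ z ∈ HStrip a b, Integrable (fun t : ℝ => Complex.exp (I * z * t)) μ ∧
        f z = ∫ t : ℝ, Complex.exp (I * z * t) ∂μ) : IsPosDefOnC f (HStrip a b) := by
  intro n z hz ξ
  have hInteg : ∀ k l, Integrable (fun t : ℝ =>
      Complex.exp (I * (z k - (starRingEnd ℂ) (z l)) * t) * ξ k * (starRingEnd ℂ) (ξ l)) μ :=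
    fun k l => ((h _ (hz k l)).1.mul_const _).mul_const _
  have e : ∑ k, ∑ l, f (z k - (starRingEnd ℂ) (z l)) * ξ k * (starRingEnd ℂ) (ξ l) =
      ∫ t : ℝ, ((Complex.normSq (∑ k, ξ k * Complex.exp (I * z k * t)) : ℝ) : ℂ) ∂μ := by
    have e1 : ∀ t : ℝ, ((Complex.normSq (∑ k, ξ k * Complex.exp (I * z k * t)) : ℝ) : ℂ) =
        ∑ k, ∑ l, Complex.exp (I * (z k - (starRingEnd ℂ) (z l)) * t) * ξ k *
          (starRingEnd ℂ) (ξ l) := by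
      intro t
      rw [Complex.normSq_eq_conj_mul_self, mul_comm, map_sum, Finset.sum_mul_sum]
      refine Finset.sum_congr rfl fun k _ => Finset.sum_congr rfl fun l _ => ?_
      have : Complex.exp (I * (z k - (starRingEnd ℂ) (z l)) * t) = Complex.exp (I * z k * t) *
          Complex.exp (-I * (starRingEnd ℂ) (z l) * t) := by
        rw [← Complex.exp_add]; ring_nf
      rw [this, map_mul, ← Complex.exp_conj]
      simp only [map_mul, Complex.conj_I, Complex.conj_ofReal]
      ring
    simp_rw [e1]
    rw [integral_finsetSum _ fun k _ => integrable_finsetSum _ fun l _ => hInteg k l]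
    refine Finset.sum_congr rfl fun k _ => ?_
    rw [integral_finsetSum _ fun l _ => hInteg k l]
    refine Finset.sum_congr rfl fun l _ => ?_
    rw [(h _ (hz k l)).2, integral_mul_const, integral_mul_const]
  rw [e, integral_complex_ofReal]
  exact_mod_cast integral_nonneg fun t => Complex.normSq_nonneg _

lemma rep_expFinite (a b : EReal) (f : ℂ → ℂ) (μ : Measure ℝ)
    (h : ∀ z ∈ HStrip a b, Integrable (fun t : ℝ => Complex.exp (I * z * t)) μ ∧
        f z = ∫ t : ℝ, Complex.exp (I * z * t) ∂μ) : ExpFinite μ a b := by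
  intro y hya hyb
  have h1 := (h (y * I) ⟨by simpa using hya, by simpa using hyb⟩).1.norm
  refine h1.congr (ae_of_all _ fun t => ?_)
  simp [Complex.norm_exp]

lemma wd_undo (μ : Measure ℝ) (y : ℝ) :
    (μ.withDensity fun t => ENNReal.ofReal (Real.exp (y * t))).withDensity
      (fun t => (ENNReal.ofReal (Real.exp (y * t)))⁻¹) = μ :=
  withDensity_inv_same (by fun_prop) (ae_of_all _ fun t => by simp [Real.exp_pos])
    (ae_of_all _ fun t => by simp)

lemma rep_unique (a b : EReal) (f : ℂ → ℂ) (hab : a < b) (μ ν : Measure ℝ)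
    (h : ∀ z ∈ HStrip a b, Integrable (fun t : ℝ => Complex.exp (I * z * t)) μ ∧
        f z = ∫ t : ℝ, Complex.exp (I * z * t) ∂μ)
    (h' : ∀ z ∈ HStrip a b, Integrable (fun t : ℝ => Complex.exp (I * z * t)) ν ∧
        f z = ∫ t : ℝ, Complex.exp (I * z * t) ∂ν) : ν = μ := by
  obtain ⟨y, hya, hyb⟩ := EReal.lt_iff_exists_real_btwn.1 hab
  have i1 : IsFiniteMeasure (μ.withDensity fun t => ENNReal.ofReal (Real.exp (-y * t))) :=
    isFiniteMeasure_withDensity_ofReal (rep_expFinite a b f μ h y hya hyb).2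
  have i2 : IsFiniteMeasure (ν.withDensity fun t => ENNReal.ofReal (Real.exp (-y * t))) :=
    isFiniteMeasure_withDensity_ofReal (rep_expFinite a b f ν h' y hya hyb).2
  have hc : ∀ (ρ : Measure ℝ), (∀ z ∈ HStrip a b,
      Integrable (fun t : ℝ => Complex.exp (I * z * t)) ρ ∧
        f z = ∫ t : ℝ, Complex.exp (I * z * t) ∂ρ) → ∀ s : ℝ,
      charFun (ρ.withDensity fun t => ENNReal.ofReal (Real.exp (-y * t))) s = f (s + y * I) := by
    intro ρ hρ s
    rw [charFun_apply_real, wd_int, (hρ (s + y * I) ⟨by simpa using hya, by simpa using hyb⟩).2]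
    congr 1
    ext t
    rw [← Complex.exp_add]
    congr 1
    push_cast
    linear_combination (-(y : ℂ) * t) * Complex.I_mul_I
  have hE : (ν.withDensity fun t => ENNReal.ofReal (Real.exp (-y * t))) =
      μ.withDensity fun t => ENNReal.ofReal (Real.exp (-y * t)) := by
    apply Measure.ext_of_charFun
    ext s
    rw [hc ν h', hc μ h]
  rw [← wd_undo ν (-y), hE, wd_undo]
/-- For `f` holomorphic on the horizontal strip `S_{a,b}`, positive definiteness of `f` on the
strip is equivalent to: a Fourier–Laplace integral representation; positive definiteness of some
horizontal section `x ↦ f(x+iy)`; and co-positive definiteness of the imaginary section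
`y ↦ f(iy)` on `(a,b)`. Moreover the representing measure is unique and exponentially finite
with respect to `(a,b)`. -/
theorem stmt7 (a b : EReal) (hab : a < b) (f : ℂ → ℂ)
    (hf : DifferentiableOn ℂ f (HStrip a b)) :
    (IsPosDefOnC f (HStrip a b) ↔
      ∃ μ : Measure ℝ, ∀ z ∈ HStrip a b,
        Integrable (fun t : ℝ => Complex.exp (I * z * t)) μ ∧
        f z = ∫ t : ℝ, Complex.exp (I * z * t) ∂μ) ∧
    (IsPosDefOnC f (HStrip a b) ↔
      ∃ y : ℝ, a < (y : EReal) ∧ (y : EReal) < b ∧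
        IsPosDefFun (fun x => f ((x : ℂ) + (y : ℂ) * I))) ∧
    (IsPosDefOnC f (HStrip a b) ↔
      IsCoPosDefOnR (fun y => f ((y : ℂ) * I))
        {y : ℝ | a < (y : EReal) ∧ (y : EReal) < b}) ∧
    (IsPosDefOnC f (HStrip a b) →
      ∃ μ : Measure ℝ,
        (∀ z ∈ HStrip a b,
          Integrable (fun t : ℝ => Complex.exp (I * z * t)) μ ∧
          f z = ∫ t : ℝ, Complex.exp (I * z * t) ∂μ) ∧
        ExpFinite μ a b ∧
        ∀ ν : Measure ℝ,
          (∀ z ∈ HStrip a b,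
            Integrable (fun t : ℝ => Complex.exp (I * z * t)) ν ∧
            f z = ∫ t : ℝ, Complex.exp (I * z * t) ∂ν) → ν = μ) := by
  have h12 : IsPosDefOnC f (HStrip a b) → IsCoPosDefOnR (fun y => f ((y : ℂ) * I))
        {y : ℝ | a < (y : EReal) ∧ (y : EReal) < b} := by
    intro h n x hx ξ
    have e : ∀ k l, (x k * I : ℂ) - (starRingEnd ℂ) (x l * I : ℂ) = ((x k + x l : ℝ) : ℂ) * I := by
      intro k l
      simp
      ring
    have := h n (fun k => x k * I) (by
      intro k l
      rw [e]
      simpa [HStrip] using hx k l) ξ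
    simp_rw [e] at this
    exact this
  have h13 : IsPosDefOnC f (HStrip a b) → ∃ y : ℝ, a < (y : EReal) ∧ (y : EReal) < b ∧
        IsPosDefFun (fun x => f ((x : ℂ) + (y : ℂ) * I)) := by
    intro h
    obtain ⟨y, hya, hyb⟩ := EReal.lt_iff_exists_real_btwn.1 hab
    refine ⟨y, hya, hyb, fun n x ξ => ?_⟩
    have e : ∀ k l, (x k + y / 2 * I : ℂ) - (starRingEnd ℂ) (x l + y / 2 * I : ℂ) =
        ((x k - x l : ℝ) : ℂ) + y * I := by
      intro k l
      rw [map_add, map_mul, map_div₀, Complex.conj_I, Complex.conj_ofReal, Complex.conj_ofReal,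
        map_ofNat]
      push_cast
      ring
    have := h n (fun k => x k + y / 2 * I) (by
      intro k l
      rw [e]
      exact ⟨by simpa using hya, by simpa using hyb⟩) ξ
    simp_rw [e] at this
    exact this
  have h32 : (∃ y : ℝ, a < (y : EReal) ∧ (y : EReal) < b ∧
        IsPosDefFun (fun x => f ((x : ℂ) + (y : ℂ) * I))) →
      ∃ μ : Measure ℝ, ∀ z ∈ HStrip a b,
        Integrable (fun t : ℝ => Complex.exp (I * z * t)) μ ∧
        f z = ∫ t : ℝ, Complex.exp (I * z * t) ∂μ := by
    rintro ⟨y, hya, hyb, h⟩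
    refine core_rep a b f hf y hya hyb I Complex.I_ne_zero fun n s =>
      Eventually.of_forall fun t ξ => ?_
    have := h n (fun k => t * s k) ξ
    convert this using 6 with k _ l _
    rw [Complex.conj_I]
    push_cast
    linear_combination (-(t : ℂ) * (s k - s l)) * Complex.I_mul_I
  have h42 : IsCoPosDefOnR (fun y => f ((y : ℂ) * I))
        {y : ℝ | a < (y : EReal) ∧ (y : EReal) < b} →
      ∃ μ : Measure ℝ, ∀ z ∈ HStrip a b,
        Integrable (fun t : ℝ => Complex.exp (I * z * t)) μ ∧
        f z = ∫ t : ℝ, Complex.exp (I * z * t) ∂μ := by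
    intro h
    obtain ⟨y, hya, hyb⟩ := EReal.lt_iff_exists_real_btwn.1 hab
    refine core_rep a b f hf y hya hyb 1 one_ne_zero fun n s => ?_
    have hev : ∀ᶠ t : ℝ in 𝓝[>] 0, ∀ k l, t * (s k + s l) ∈
        {x : ℝ | a < ((y - x : ℝ) : EReal) ∧ ((y - x : ℝ) : EReal) < b} := by
      refine eventually_all.2 fun k => eventually_all.2 fun l => ?_
      have hc : ContinuousAt (fun t : ℝ => t * (s k + s l)) 0 := by fun_prop
      refine nhdsWithin_le_nhds (hc.eventually_mem ((vset_open a b y).mem_nhds ?_))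
      simp [hya, hyb]
    filter_upwards [hev] with t ht ξ
    have e : ∀ k l, (y / 2 - t * s k) + (y / 2 - t * s l) = y - t * (s k + s l) := by
      intro k l
      ring
    have := h n (fun k => y / 2 - t * s k) (by
      intro k l
      simp only [e]
      exact ht k l) ξ
    simp only [e] at this
    convert this using 6
    simp
    ring
  refine ⟨⟨fun h => h42 (h12 h), fun ⟨μ, hμ⟩ => rep_posDef a b f μ hμ⟩,
    ⟨h13, fun h => ?_⟩, ⟨h12, fun h => ?_⟩, fun h => ?_⟩
  · obtain ⟨μ, hμ⟩ := h32 h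
    exact rep_posDef a b f μ hμ
  · obtain ⟨μ, hμ⟩ := h42 h
    exact rep_posDef a b f μ hμ
  · obtain ⟨μ, hμ⟩ := h42 (h12 h)
    exact ⟨μ, hμ, rep_expFinite a b f μ hμ, fun ν hν => rep_unique a b f hab μ ν hμ hν⟩
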